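/- Let μ be a finite positive Borel measure on the unit circle ∂𝔻, let f be an analytic function on 𝔻 belonging to the Bergman space A² (i.e. ∫_𝔻 |f|² dA < ∞), and fix any r > 0. The following are equivalent: (i) ∫_𝔻 |f'(z)|² P_μ(z) dA(z) < ∞ (i.e. f ∈ D(μ)); (ii) ∫_𝔻 (MOf(z))² P_μ(z) dτ(z) < ∞; (iii) ∫_𝔻 (MO_r f(z))² P_μ(z) dτ(z) < ∞. -/

import Mathlib

open MeasureTheory

noncomputable section

/-- The Poisson integral `P_μ(z) = (1/2π) ∫_{∂𝔻} (1-|z|²)/|ζ-z|² dμ(ζ)` of a measure `μ`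
on the unit circle. -/
def poissonInt (μ : Measure ℂ) (z : ℂ) : ℝ :=
  (2 * Real.pi)⁻¹ * ∫ ζ, (1 - ‖z‖ ^ 2) / ‖ζ - z‖ ^ 2 ∂μ

/-- The Möbius transformation `φ_z(w) = (z - w)/(1 - z̄w)`. -/
def moebius (z w : ℂ) : ℂ := (z - w) / (1 - (starRingEnd ℂ) z * w)

/-- The Bergman metric `d(z,w) = log((1+|φ_z(w)|)/(1-|φ_z(w)|))`. -/
def bdist (z w : ℂ) : ℝ := Real.log ((1 + ‖moebius z w‖) / (1 - ‖moebius z w‖))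

/-- The Bergman ball `B(z,r) = {w ∈ 𝔻 : d(z,w) < r}`. -/
def bball (z : ℂ) (r : ℝ) : Set ℂ := {w : ℂ | w ∈ Metric.ball (0:ℂ) 1 ∧ bdist z w < r}

/-- The mean oscillation `MOf(z) = (∫_𝔻 |f(φ_z(w)) - f(z)|² dA(w))^{1/2}`. -/
def MO (f : ℂ → ℂ) (z : ℂ) : ℝ :=
  Real.sqrt (∫ w in Metric.ball (0:ℂ) 1, ‖f (moebius z w) - f z‖ ^ 2)

/-- The average `f̂_r(z)` of `f` over the Bergman ball `B(z,r)`. -/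
def bAvg (f : ℂ → ℂ) (r : ℝ) (z : ℂ) : ℂ :=
  (volume (bball z r)).toReal⁻¹ • ∫ w in bball z r, f w

/-- The mean oscillation of `f` at `z` in the Bergman metric,
`MO_r f(z) = ((1/|B(z,r)|) ∫_{B(z,r)} |f(w) - f̂_r(z)|² dA(w))^{1/2}`. -/
def MOr (f : ℂ → ℂ) (r : ℝ) (z : ℂ) : ℝ :=
  Real.sqrt ((volume (bball z r)).toReal⁻¹ * ∫ w in bball z r, ‖f w - bAvg f r z‖ ^ 2)

/-- The real Jacobian `|φ_z'(w)|²` of the Möbius transformation `φ_z`. -/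
def moebiusJac (z w : ℂ) : ℝ := ((1 - ‖z‖ ^ 2) / ‖1 - (starRingEnd ℂ) z * w‖ ^ 2) ^ 2

theorem one_sub_conj_mul_ne_zero {z w : ℂ} (hz : ‖z‖ < 1) (hw : ‖w‖ ≤ 1) :
    1 - (starRingEnd ℂ) z * w ≠ 0 := by
  intro h
  have h1 : (1 : ℂ) = (starRingEnd ℂ) z * w := sub_eq_zero.mp h
  have h2 : (1 : ℝ) = ‖z‖ * ‖w‖ := by
    have := congrArg norm h1
    simpa using this
  nlinarith [norm_nonneg z, norm_nonneg w]

theorem norm_sq_one_sub_conj_mul_sub (z w : ℂ) :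
    ‖1 - (starRingEnd ℂ) z * w‖ ^ 2 - ‖z - w‖ ^ 2 = (1 - ‖z‖ ^ 2) * (1 - ‖w‖ ^ 2) := by
  simp only [Complex.sq_norm, Complex.normSq_apply, Complex.sub_re, Complex.sub_im,
    Complex.mul_re, Complex.mul_im, Complex.conj_re, Complex.conj_im, Complex.one_re,
    Complex.one_im]
  ring

theorem one_sub_norm_moebius_sq {z w : ℂ} (hz : ‖z‖ < 1) (hw : ‖w‖ ≤ 1) :
    1 - ‖moebius z w‖ ^ 2
      = (1 - ‖z‖ ^ 2) * (1 - ‖w‖ ^ 2) / ‖1 - (starRingEnd ℂ) z * w‖ ^ 2 := by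
  have h : ‖1 - (starRingEnd ℂ) z * w‖ ≠ 0 := norm_ne_zero_iff.mpr (one_sub_conj_mul_ne_zero hz hw)
  rw [moebius, norm_div, div_pow, ← norm_sq_one_sub_conj_mul_sub, sub_div,
    div_self (pow_ne_zero 2 h)]

theorem norm_moebius_lt_one {z w : ℂ} (hz : ‖z‖ < 1) (hw : ‖w‖ < 1) : ‖moebius z w‖ < 1 := by
  have h : 0 < ‖1 - (starRingEnd ℂ) z * w‖ :=
    norm_pos_iff.mpr (one_sub_conj_mul_ne_zero hz hw.le)
  have h1 : 0 < 1 - ‖z‖ ^ 2 := by nlinarith [norm_nonneg z]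
  have h2 : 0 < 1 - ‖w‖ ^ 2 := by nlinarith [norm_nonneg w]
  have h3 : 0 < 1 - ‖moebius z w‖ ^ 2 := by
    rw [one_sub_norm_moebius_sq hz hw.le]; positivity
  nlinarith [norm_nonneg (moebius z w)]

theorem norm_moebius_eq_one {z w : ℂ} (hz : ‖z‖ < 1) (hw : ‖w‖ = 1) : ‖moebius z w‖ = 1 := by
  have h3 := one_sub_norm_moebius_sq hz hw.le
  rw [hw] at h3
  have : ‖moebius z w‖ ^ 2 = 1 := by
    have : (1 - ‖z‖ ^ 2) * (1 - (1 : ℝ) ^ 2) / ‖1 - (starRingEnd ℂ) z * w‖ ^ 2 = 0 := by simp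
    linarith
  nlinarith [norm_nonneg (moebius z w)]

theorem moebius_zero_right (z : ℂ) : moebius z 0 = z := by simp [moebius]

theorem moebius_moebius {z w : ℂ} (hz : ‖z‖ < 1) (hw : ‖w‖ < 1) :
    moebius z (moebius z w) = w := by
  have h := one_sub_conj_mul_ne_zero hz hw.le
  have h' := one_sub_conj_mul_ne_zero hz (norm_moebius_lt_one hz hw).le
  rw [moebius, div_eq_iff h', moebius]
  generalize (starRingEnd ℂ) z = a at h
  have h'' : 1 - w * a ≠ 0 := by rwa [mul_comm]
  field_simp
  ring

theorem norm_one_sub_conj_mul_comm (z w : ℂ) :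
    ‖1 - (starRingEnd ℂ) z * w‖ = ‖1 - (starRingEnd ℂ) w * z‖ := by
  rw [← Complex.norm_conj]
  simp [mul_comm]

theorem norm_moebius_comm (z w : ℂ) : ‖moebius z w‖ = ‖moebius w z‖ := by
  rw [moebius, moebius, norm_div, norm_div, norm_one_sub_conj_mul_comm, norm_sub_rev]

theorem moebius_image_ball {z : ℂ} (hz : ‖z‖ < 1) :
    moebius z '' Metric.ball 0 1 = Metric.ball 0 1 := by
  ext w
  simp only [Set.mem_image, Metric.mem_ball, dist_zero_right]
  constructor
  · rintro ⟨x, hx, rfl⟩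
    exact norm_moebius_lt_one hz hx
  · intro hw
    exact ⟨moebius z w, norm_moebius_lt_one hz hw, moebius_moebius hz hw⟩

theorem bball_eq_moebius_image {z : ℂ} (hz : ‖z‖ < 1) (r : ℝ) :
    bball z r = moebius z '' Metric.ball 0 ((Real.exp r - 1) / (Real.exp r + 1)) := by
  have he := Real.exp_pos r
  have hs : (Real.exp r - 1) / (Real.exp r + 1) < 1 := by
    rw [div_lt_one (by linarith)]; linarith
  have key : ∀ w : ℂ, ‖w‖ < 1 →
      (bdist z w < r ↔ ‖moebius z w‖ < (Real.exp r - 1) / (Real.exp r + 1)) := by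
    intro w hw
    have h1 := norm_moebius_lt_one hz hw
    have h0 := norm_nonneg (moebius z w)
    rw [bdist, Real.log_lt_iff_lt_exp (div_pos (by linarith) (by linarith)),
      div_lt_iff₀ (by linarith), lt_div_iff₀ (by linarith)]
    constructor <;> intro h <;> nlinarith
  ext w
  simp only [bball, Set.mem_ofPred_eq, Set.mem_image, Metric.mem_ball, dist_zero_right]
  constructor
  · rintro ⟨hw, hd⟩
    exact ⟨moebius z w, (key w hw).mp hd, moebius_moebius hz hw⟩
  · rintro ⟨x, hx, rfl⟩
    have hx1 := hx.trans hs
    refine ⟨norm_moebius_lt_one hz hx1, (key _ (norm_moebius_lt_one hz hx1)).mpr ?_⟩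
    rwa [moebius_moebius hz hx1]

theorem hasDerivAt_moebius {z w : ℂ} (hz : ‖z‖ < 1) (hw : ‖w‖ < 1) :
    HasDerivAt (moebius z) (-(1 - (‖z‖ : ℂ) ^ 2) / (1 - (starRingEnd ℂ) z * w) ^ 2) w := by
  have h := one_sub_conj_mul_ne_zero hz hw.le
  have h1 : HasDerivAt (fun w : ℂ => z - w) (-1) w := by
    simpa using (hasDerivAt_id w).const_sub z
  have h2 : HasDerivAt (fun w : ℂ => 1 - (starRingEnd ℂ) z * w) (-(starRingEnd ℂ) z) w := by
    simpa using ((hasDerivAt_id w).const_mul ((starRingEnd ℂ) z)).const_sub 1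
  have h3 : HasDerivAt (moebius z) _ w := h1.div h2 h
  have h4 : -(1 - (‖z‖ : ℂ) ^ 2)
      = -1 * (1 - (starRingEnd ℂ) z * w) - (z - w) * -(starRingEnd ℂ) z := by
    rw [← Complex.conj_mul']
    ring
  rwa [h4]

theorem norm_deriv_moebius_sq {z w : ℂ} (hz : ‖z‖ < 1) :
    ‖-(1 - (‖z‖ : ℂ) ^ 2) / (1 - (starRingEnd ℂ) z * w) ^ 2‖ ^ 2 = moebiusJac z w := by
  have h : ‖(1 - (‖z‖ : ℂ) ^ 2)‖ = 1 - ‖z‖ ^ 2 := by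
    have : (1 - (‖z‖ : ℂ) ^ 2) = ((1 - ‖z‖ ^ 2 : ℝ) : ℂ) := by push_cast; rfl
    rw [this, Complex.norm_real, Real.norm_of_nonneg]
    nlinarith [norm_nonneg z]
  rw [norm_div, norm_neg, h, norm_pow, moebiusJac]

theorem abs_det_restrictScalars_toSpanSingleton (d : ℂ) :
    |(ContinuousLinearMap.restrictScalars ℝ
      (ContinuousLinearMap.toSpanSingleton ℂ d : ℂ →L[ℂ] ℂ)).det| = ‖d‖ ^ 2 := by
  have : ((ContinuousLinearMap.restrictScalars ℝ
      (ContinuousLinearMap.toSpanSingleton ℂ d : ℂ →L[ℂ] ℂ)).det) = ‖d‖ ^ 2 := by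
    simp [ContinuousLinearMap.det, LinearMap.det_restrictScalars, Algebra.norm_complex_apply,
      Complex.normSq_eq_norm_sq]
  rw [this, abs_of_nonneg (by positivity)]

theorem lintegral_moebius_image {z : ℂ} (hz : ‖z‖ < 1) {s : ℝ} (hs : s ≤ 1) (F : ℂ → ENNReal) :
    ∫⁻ x in moebius z '' Metric.ball 0 s, F x
      = ∫⁻ w in Metric.ball 0 s, ENNReal.ofReal (moebiusJac z w) * F (moebius z w) := by
  have hmem : ∀ w ∈ Metric.ball (0 : ℂ) s, ‖w‖ < 1 := fun w hw =>
    lt_of_lt_of_le (by simpa using hw) hs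
  rw [lintegral_image_eq_lintegral_abs_det_fderiv_mul volume Metric.isOpen_ball.measurableSet
    (fun w hw => ((hasDerivAt_moebius hz (hmem w hw)).hasFDerivAt.restrictScalars
      ℝ).hasFDerivWithinAt)
    (fun x hx y hy hxy => by
      rw [← moebius_moebius hz (hmem x hx), hxy, moebius_moebius hz (hmem y hy)])]
  refine setLIntegral_congr_fun Metric.isOpen_ball.measurableSet fun w hw => ?_
  rw [abs_det_restrictScalars_toSpanSingleton, norm_deriv_moebius_sq hz]

theorem lintegral_ball_moebius {z : ℂ} (hz : ‖z‖ < 1) (F : ℂ → ENNReal) :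
    ∫⁻ w in Metric.ball 0 1, ENNReal.ofReal (moebiusJac z w) * F (moebius z w)
      = ∫⁻ x in Metric.ball 0 1, F x := by
  rw [← lintegral_moebius_image hz le_rfl, moebius_image_ball hz]

theorem enorm_integral_sq_le {α E : Type*} [MeasurableSpace α] [NormedAddCommGroup E]
    [NormedSpace ℝ E] {ν : Measure α} {F : α → E} (hF : AEStronglyMeasurable F ν) :
    ‖∫ x, F x ∂ν‖ₑ ^ 2 ≤ ν Set.univ * ∫⁻ x, ‖F x‖ₑ ^ 2 ∂ν := by
  have h := ENNReal.lintegral_mul_le_Lp_mul_Lq ν Real.HolderConjugate.two_two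
    (f := fun _ => 1) (g := fun x => ‖F x‖ₑ) aemeasurable_const hF.enorm
  simp only [Pi.mul_apply, one_mul, ENNReal.one_rpow, lintegral_const] at h
  have h2 : ‖∫ x, F x ∂ν‖ₑ ≤ _ := (enorm_integral_le_lintegral_enorm F).trans h
  refine (pow_le_pow_left' h2 2).trans_eq ?_
  rw [mul_pow, ← ENNReal.rpow_natCast, ← ENNReal.rpow_natCast, ← ENNReal.rpow_mul,
    ← ENNReal.rpow_mul]
  norm_num

open Real in
theorem lintegral_ball_eq_polar (s : ℝ) (F : ℂ → ENNReal) :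
    ∫⁻ w in Metric.ball 0 s, F w
      = ∫⁻ p in Set.Ioo 0 s ×ˢ Set.Ioo (-π) π,
          ENNReal.ofReal p.1 * F (circleMap 0 p.1 p.2) := by
  have hS : MeasurableSet (Set.Ioo 0 s ×ˢ Set.Ioo (-π) π) :=
    measurableSet_Ioo.prod measurableSet_Ioo
  have hT : MeasurableSet (Set.Ioi (0 : ℝ) ×ˢ Set.Ioo (-π) π) :=
    measurableSet_Ioi.prod measurableSet_Ioo
  rw [← lintegral_indicator Metric.isOpen_ball.measurableSet,
    ← Complex.lintegral_comp_polarCoord_symm, polarCoord_target, ← lintegral_indicator hT,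
    ← lintegral_indicator hS]
  congr 1
  ext ⟨ρ, θ⟩
  have hc : Complex.polarCoord.symm (ρ, θ) = circleMap 0 ρ θ := by
    simp [circleMap, Complex.exp_mul_I]
  simp only [Set.indicator, hc, Set.mem_prod, Set.mem_Ioi, Set.mem_Ioo, Metric.mem_ball,
    dist_zero_right, norm_circleMap_zero, smul_eq_mul]
  by_cases h0 : 0 < ρ
  · simp only [h0, true_and, abs_of_pos h0]
    split_ifs <;> simp_all
  · simp [h0]

theorem aemeasurable_comp_circleMap {s : ℝ} {g : ℂ → ℂ} (hg : ContinuousOn g (Metric.ball 0 s)) :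
    AEMeasurable (fun p : ℝ × ℝ => g (circleMap 0 p.1 p.2))
      (volume.restrict (Set.Ioo 0 s ×ˢ Set.Ioo (-Real.pi) Real.pi)) := by
  refine ContinuousOn.aemeasurable ?_ (measurableSet_Ioo.prod measurableSet_Ioo)
  refine hg.comp (f := fun p : ℝ × ℝ => circleMap 0 p.1 p.2) ?_ ?_
  · simp only [circleMap]; fun_prop
  · rintro ⟨ρ, θ⟩ ⟨h, -⟩
    simpa [abs_of_pos h.1] using h.2

open Real in
theorem circleAverage_eq_setIntegral {E : Type*} [NormedAddCommGroup E] [NormedSpace ℝ E]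
    (F : ℂ → E) (R : ℝ) :
    Real.circleAverage F 0 R = (2 * π)⁻¹ • ∫ θ in Set.Ioo (-π) π, F (circleMap 0 R θ) := by
  rw [Real.circleAverage_eq_integral_add (-π),
    intervalIntegral.integral_comp_add_right (fun θ => F (circleMap 0 R θ)), zero_add,
    show 2 * π + -π = π by ring, intervalIntegral.integral_of_le (by linarith [pi_pos]),
    integral_Ioc_eq_integral_Ioo]

open Real in
theorem circleAverage_poisson {ζ : ℂ} (hζ : ‖ζ‖ = 1) {ρ : ℝ} (h0 : 0 < ρ) (h1 : ρ < 1) :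
    Real.circleAverage (fun w => (1 - ‖w‖ ^ 2) / ‖ζ - w‖ ^ 2) 0 ρ = 1 := by
  have hne : ∀ w ∈ Metric.closedBall (0 : ℂ) ρ, ζ - w ≠ 0 := by
    intro w hw h
    have : ‖w‖ ≤ ρ := by simpa using hw
    rw [← sub_eq_zero.mp h, hζ] at this
    linarith
  have hd : DifferentiableOn ℂ (fun w => (ζ + w) / (ζ - w)) (Metric.closedBall 0 ρ) := by
    intro w hw
    have := hne w hw
    exact DifferentiableAt.differentiableWithinAt (by fun_prop (disch := assumption))
  have hdc : DiffContOnCl ℂ (fun w => (ζ + w) / (ζ - w)) (Metric.ball 0 |ρ|) := by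
    rw [abs_of_pos h0]
    refine DifferentiableOn.diffContOnCl ?_
    rwa [closure_ball _ h0.ne']
  have hre : (fun w => (1 - ‖w‖ ^ 2) / ‖ζ - w‖ ^ 2)
      = Complex.reCLM ∘ (fun w => (ζ + w) / (ζ - w)) := by
    ext w
    have := congrFun (poissonKernel_eq_re_herglotzRieszKernel (c := 0) (w := w)) ζ
    simpa [poissonKernel_def, herglotzRieszKernel, hζ] using this
  rw [hre, Complex.reCLM.circleAverage_comp_comm, hdc.circleAverage]
  · have : ζ ≠ 0 := by rintro rfl; simp at hζ
    simp [this]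
  · refine ContinuousOn.circleIntegrable h0.le ?_
    exact hd.continuousOn.mono Metric.sphere_subset_closedBall

open Real in
theorem lintegral_poisson_div_norm_le {ζ : ℂ} (hζ : ‖ζ‖ = 1) :
    ∫⁻ w in Metric.ball (0 : ℂ) 1,
      ENNReal.ofReal ((1 - ‖w‖ ^ 2) / ‖ζ - w‖ ^ 2) * ENNReal.ofReal ‖w‖⁻¹
      ≤ ENNReal.ofReal (2 * π) := by
  have hm : Measurable fun p : ℝ × ℝ => ENNReal.ofReal p.1 *
      (ENNReal.ofReal ((1 - ‖circleMap 0 p.1 p.2‖ ^ 2) / ‖ζ - circleMap 0 p.1 p.2‖ ^ 2)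
        * ENNReal.ofReal ‖circleMap 0 p.1 p.2‖⁻¹) := by
    simp only [circleMap]; fun_prop
  rw [lintegral_ball_eq_polar, Measure.volume_eq_prod, ← Measure.prod_restrict,
    lintegral_prod _ hm.aemeasurable]
  have hin : ∀ ρ ∈ Set.Ioo (0 : ℝ) 1, ∫⁻ θ in Set.Ioo (-π) π, ENNReal.ofReal ρ *
      (ENNReal.ofReal ((1 - ‖circleMap 0 ρ θ‖ ^ 2) / ‖ζ - circleMap 0 ρ θ‖ ^ 2)
        * ENNReal.ofReal ‖circleMap 0 ρ θ‖⁻¹) = ENNReal.ofReal (2 * π) := by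
    rintro ρ ⟨h0, h1⟩
    have hne : ∀ θ, ‖ζ - circleMap 0 ρ θ‖ ≠ 0 := by
      intro θ h
      have := congrArg norm (sub_eq_zero.mp (norm_eq_zero.mp h))
      rw [hζ, norm_circleMap_zero, abs_of_pos h0] at this
      linarith
    have hcont : Continuous fun θ => (1 - ‖circleMap 0 ρ θ‖ ^ 2) / ‖ζ - circleMap 0 ρ θ‖ ^ 2 := by
      refine Continuous.div ?_ ?_ fun θ => pow_ne_zero 2 (hne θ)
      · fun_prop
      · fun_prop
    have hint : IntegrableOn (fun θ => (1 - ‖circleMap 0 ρ θ‖ ^ 2) / ‖ζ - circleMap 0 ρ θ‖ ^ 2)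
        (Set.Ioo (-π) π) :=
      (hcont.integrableOn_Icc (a := -π) (b := π)).mono_set Set.Ioo_subset_Icc_self
    have hav := circleAverage_eq_setIntegral (fun w => (1 - ‖w‖ ^ 2) / ‖ζ - w‖ ^ 2) ρ
    rw [circleAverage_poisson hζ h0 h1] at hav
    have hval : ∫ θ in Set.Ioo (-π) π,
        (1 - ‖circleMap 0 ρ θ‖ ^ 2) / ‖ζ - circleMap 0 ρ θ‖ ^ 2 = 2 * π := by
      have hpi := pi_pos
      rw [smul_eq_mul, eq_comm, inv_mul_eq_iff_eq_mul₀ (by positivity)] at hav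
      linarith
    rw [← hval, ofReal_integral_eq_lintegral_ofReal hint]
    · refine lintegral_congr fun θ => ?_
      have hc : ENNReal.ofReal ρ * ENNReal.ofReal ρ⁻¹ = 1 := by
        rw [← ENNReal.ofReal_mul h0.le, mul_inv_cancel₀ h0.ne', ENNReal.ofReal_one]
      rw [norm_circleMap_zero, abs_of_pos h0, mul_left_comm, hc, mul_one]
    · refine Filter.Eventually.of_forall fun θ => ?_
      simp only [norm_circleMap_zero, Pi.zero_apply, sq_abs]
      exact div_nonneg (by nlinarith) (by positivity)
  rw [setLIntegral_congr_fun measurableSet_Ioo hin]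
  simp

open Real in
theorem enorm_deriv_sq_le_circle {g : ℂ → ℂ} (hg : DifferentiableOn ℂ g (Metric.ball 0 1))
    (c : ℂ) {ρ : ℝ} (h0 : 0 < ρ) (h1 : ρ < 1) :
    ENNReal.ofReal (2 * π * ρ ^ 2) * ‖deriv g 0‖ₑ ^ 2
      ≤ ∫⁻ θ in Set.Ioo (-π) π, ‖g (circleMap 0 ρ θ) - c‖ₑ ^ 2 := by
  have hpi := pi_pos
  have hsub : Metric.closedBall (0 : ℂ) ρ ⊆ Metric.ball 0 1 := Metric.closedBall_subset_ball h1
  have hd : DiffContOnCl ℂ (fun w => g w - c) (Metric.ball 0 ρ) := by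
    refine DifferentiableOn.diffContOnCl ?_
    rw [closure_ball _ h0.ne']
    exact (hg.mono hsub).sub_const c
  have hgc : ∀ θ, circleMap 0 ρ θ ∈ Metric.ball (0 : ℂ) 1 := fun θ => by
    simpa [abs_of_pos h0] using h1
  have hcont : Continuous fun θ => g (circleMap 0 ρ θ) :=
    hg.continuousOn.comp_continuous (continuous_circleMap 0 ρ) hgc
  have hne : ∀ θ, circleMap 0 ρ θ ≠ 0 := fun θ => circleMap_ne_center h0.ne'
  have hav : Real.circleAverage (fun w => w⁻¹ * (g w - c)) 0 ρ = deriv g 0 := by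
    rw [Real.circleAverage_eq_circleIntegral h0.ne']
    have := hd.deriv_eq_smul_circleIntegral h0
    rw [deriv_sub_const_fun] at this
    rw [inv_smul_eq_iff₀ (by simp [hpi.ne']), ← this]
    congr 1
    ext z
    simp [pow_two, mul_assoc]
  rw [circleAverage_eq_setIntegral, inv_smul_eq_iff₀ (by positivity)] at hav
  have hJ := enorm_integral_sq_le (ν := volume.restrict (Set.Ioo (-π) π))
    (F := fun θ => (circleMap 0 ρ θ)⁻¹ * (g (circleMap 0 ρ θ) - c))
    (Continuous.aestronglyMeasurable
      (((continuous_circleMap 0 ρ).inv₀ hne).mul (hcont.sub continuous_const)))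
  have hint : ∫⁻ θ in Set.Ioo (-π) π, ‖(circleMap 0 ρ θ)⁻¹ * (g (circleMap 0 ρ θ) - c)‖ₑ ^ 2
      = ENNReal.ofReal (ρ⁻¹ ^ 2) * ∫⁻ θ in Set.Ioo (-π) π, ‖g (circleMap 0 ρ θ) - c‖ₑ ^ 2 := by
    rw [← lintegral_const_mul' _ _ ENNReal.ofReal_ne_top]
    refine lintegral_congr fun θ => ?_
    rw [enorm_mul, mul_pow, ← ofReal_norm, norm_inv, norm_circleMap_zero, abs_of_pos h0,
      ← ENNReal.ofReal_pow (by positivity)]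
  rw [hav, hint, enorm_smul, mul_pow, Measure.restrict_apply_univ, Real.volume_Ioo,
    show π - -π = 2 * π by ring, ← ofReal_norm (2 * π), norm_of_nonneg (by positivity),
    ← ENNReal.ofReal_pow (by positivity), ← mul_assoc,
    ← ENNReal.ofReal_mul (by positivity)] at hJ
  have hJ' := mul_le_mul_right hJ (ENNReal.ofReal (ρ ^ 2 * (2 * π)⁻¹))
  rw [← mul_assoc, ← mul_assoc, ← ENNReal.ofReal_mul (by positivity),
    ← ENNReal.ofReal_mul (by positivity)] at hJ'
  convert hJ' using 3
  · field_simp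
  · rw [show ρ ^ 2 * (2 * π)⁻¹ * (2 * π * ρ⁻¹ ^ 2) = 1 by field_simp]
    simp

open Real in
theorem enorm_deriv_sq_le_disc {g : ℂ → ℂ} (hg : DifferentiableOn ℂ g (Metric.ball 0 1))
    (c : ℂ) {s : ℝ} (h0 : 0 < s) (h1 : s ≤ 1) :
    ENNReal.ofReal (π * s ^ 4 / 8) * ‖deriv g 0‖ₑ ^ 2
      ≤ ∫⁻ w in Metric.ball 0 s, ‖g w - c‖ₑ ^ 2 := by
  have hpi := pi_pos
  have hm : AEMeasurable (fun p : ℝ × ℝ => ENNReal.ofReal p.1 *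
      ‖g (circleMap 0 p.1 p.2) - c‖ₑ ^ 2)
      (volume.restrict (Set.Ioo 0 s ×ˢ Set.Ioo (-π) π)) := by
    have := aemeasurable_comp_circleMap (hg.continuousOn.mono (Metric.ball_subset_ball h1))
    exact (by fun_prop : Measurable fun p : ℝ × ℝ => ENNReal.ofReal p.1).aemeasurable.mul
      ((this.sub_const c).enorm.pow_const 2)
  rw [lintegral_ball_eq_polar]
  rw [Measure.volume_eq_prod, ← Measure.prod_restrict] at hm ⊢
  rw [lintegral_prod _ hm]
  calc ENNReal.ofReal (π * s ^ 4 / 8) * ‖deriv g 0‖ₑ ^ 2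
      = ∫⁻ ρ in Set.Ioo (s / 2) s,
          ENNReal.ofReal (s / 2) * (ENNReal.ofReal (2 * π * (s / 2) ^ 2) * ‖deriv g 0‖ₑ ^ 2) := by
        rw [lintegral_const, Measure.restrict_apply_univ, Real.volume_Ioo, ← mul_assoc,
          ← ENNReal.ofReal_mul (by positivity), mul_right_comm,
          ← ENNReal.ofReal_mul (by positivity)]
        congr 2
        ring
    _ ≤ ∫⁻ ρ in Set.Ioo (s / 2) s, ∫⁻ θ in Set.Ioo (-π) π,
          ENNReal.ofReal ρ * ‖g (circleMap 0 ρ θ) - c‖ₑ ^ 2 := by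
        refine setLIntegral_mono' measurableSet_Ioo fun ρ hρ => ?_
        rw [lintegral_const_mul' _ _ ENNReal.ofReal_ne_top]
        refine mul_le_mul' (ENNReal.ofReal_le_ofReal hρ.1.le) ?_
        refine le_trans ?_ (enorm_deriv_sq_le_circle hg c (by linarith [hρ.1])
          (hρ.2.trans_le h1))
        gcongr
        exact hρ.1.le
    _ ≤ _ := lintegral_mono_set (Set.Ioo_subset_Ioo_left (by positivity))

theorem intervalIntegral_hardy {H H' : ℝ → ℂ} {X : ℝ} (hX0 : 0 ≤ X) (hX1 : X ≤ 1)
    (hd : ∀ x ∈ Set.Icc 0 X, HasDerivAt H (H' x) x) (hc : ContinuousOn H' (Set.Icc 0 X))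
    (h0 : H 0 = 0) :
    ∫ x in 0..X, ‖H x‖ ^ 2 ≤ ∫ x in 0..X, 4 * (‖H' x‖ ^ 2 * (1 - x) ^ 2) := by
  have hHc : ContinuousOn H (Set.Icc 0 X) := fun x hx => (hd x hx).continuousAt.continuousWithinAt
  have hu : Set.uIcc 0 X = Set.Icc 0 X := Set.uIcc_of_le hX0
  have hder : ∀ x ∈ Set.uIcc 0 X, HasDerivAt (fun x => 2 * ((1 - x) * ‖H x‖ ^ 2))
      (2 * (-1 * ‖H x‖ ^ 2 + (1 - x) * (2 * inner ℝ (H x) (H' x)))) x := by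
    intro x hx
    rw [hu] at hx
    have h1 : HasDerivAt (fun x : ℝ => 1 - x) (-1) x := by
      simpa using (hasDerivAt_id x).const_sub 1
    exact (h1.mul (hd x hx).norm_sq).const_mul 2
  have i1 : IntervalIntegrable (fun x => ‖H x‖ ^ 2) volume 0 X := by
    refine ContinuousOn.intervalIntegrable ?_
    rw [hu]; fun_prop
  have i2 : IntervalIntegrable (fun x => 4 * (‖H' x‖ ^ 2 * (1 - x) ^ 2)) volume 0 X := by
    refine ContinuousOn.intervalIntegrable ?_
    rw [hu]; fun_prop
  have i3 : IntervalIntegrable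
      (fun x => 2 * (-1 * ‖H x‖ ^ 2 + (1 - x) * (2 * inner ℝ (H x) (H' x)))) volume 0 X := by
    refine ContinuousOn.intervalIntegrable ?_
    rw [hu]
    have : ContinuousOn (fun x => inner ℝ (H x) (H' x)) (Set.Icc 0 X) := hHc.inner hc
    fun_prop
  have hftc := intervalIntegral.integral_eq_sub_of_hasDerivAt hder i3
  have hmono := intervalIntegral.integral_mono_on hX0 i3 (i2.sub i1) (fun x hx => by
    have h1 : 0 ≤ 1 - x := by linarith [hx.2]
    have h2 := real_inner_le_norm (H x) (H' x)
    have h3 := mul_le_mul_of_nonneg_left h2 h1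
    nlinarith [sq_nonneg (‖H x‖ - 2 * ((1 - x) * ‖H' x‖))])
  rw [hftc, intervalIntegral.integral_sub i2 i1, h0] at hmono
  have : 0 ≤ 2 * ((1 - X) * ‖H X‖ ^ 2) :=
    mul_nonneg zero_le_two (mul_nonneg (by linarith) (by positivity))
  simp only [norm_zero] at hmono
  linarith

theorem lintegral_hardy {H H' : ℝ → ℂ} (hd : ∀ x ∈ Set.Ico 0 1, HasDerivAt H (H' x) x)
    (hc : ContinuousOn H' (Set.Ico 0 1)) (h0 : H 0 = 0) :
    ∫⁻ x in Set.Ioo 0 1, ‖H x‖ₑ ^ 2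
      ≤ 4 * ∫⁻ x in Set.Ioo 0 1, ‖H' x‖ₑ ^ 2 * ENNReal.ofReal ((1 - x) ^ 2) := by
  have hbound : ∀ X : ℝ, 0 ≤ X → X < 1 → ∫⁻ x in Set.Ioc 0 X, ‖H x‖ₑ ^ 2
      ≤ 4 * ∫⁻ x in Set.Ioo 0 1, ‖H' x‖ₑ ^ 2 * ENNReal.ofReal ((1 - x) ^ 2) := by
    intro X hX0 hX1
    have hsub : Set.Icc 0 X ⊆ Set.Ico 0 1 := fun x hx => ⟨hx.1, hx.2.trans_lt hX1⟩
    have hHc : ContinuousOn H (Set.Icc 0 X) :=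
      fun x hx => (hd x (hsub hx)).continuousAt.continuousWithinAt
    have hHc' : ContinuousOn H' (Set.Icc 0 X) := hc.mono hsub
    have h := intervalIntegral_hardy hX0 hX1.le (fun x hx => hd x (hsub hx)) hHc' h0
    rw [intervalIntegral.integral_of_le hX0, intervalIntegral.integral_of_le hX0] at h
    have i1 : IntegrableOn (fun x => ‖H x‖ ^ 2) (Set.Ioc 0 X) :=
      (ContinuousOn.integrableOn_Icc (by fun_prop)).mono_set Set.Ioc_subset_Icc_self
    have i2 : IntegrableOn (fun x => 4 * (‖H' x‖ ^ 2 * (1 - x) ^ 2)) (Set.Ioc 0 X) :=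
      (ContinuousOn.integrableOn_Icc (by fun_prop)).mono_set Set.Ioc_subset_Icc_self
    have h' := ENNReal.ofReal_le_ofReal h
    rw [ofReal_integral_eq_lintegral_ofReal i1 (Filter.Eventually.of_forall fun x => by positivity),
      ofReal_integral_eq_lintegral_ofReal i2
        (Filter.Eventually.of_forall fun x => by positivity)] at h'
    calc ∫⁻ x in Set.Ioc 0 X, ‖H x‖ₑ ^ 2
        = ∫⁻ x in Set.Ioc 0 X, ENNReal.ofReal (‖H x‖ ^ 2) := by
          simp only [ENNReal.ofReal_pow (norm_nonneg _), ofReal_norm]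
      _ ≤ _ := h'
      _ = ∫⁻ x in Set.Ioc 0 X, 4 * (‖H' x‖ₑ ^ 2 * ENNReal.ofReal ((1 - x) ^ 2)) := by
          refine lintegral_congr fun x => ?_
          rw [ENNReal.ofReal_mul (by norm_num), ENNReal.ofReal_mul (by positivity),
            ENNReal.ofReal_pow (norm_nonneg _), ofReal_norm]
          norm_num
      _ ≤ ∫⁻ x in Set.Ioo 0 1, 4 * (‖H' x‖ₑ ^ 2 * ENNReal.ofReal ((1 - x) ^ 2)) :=
          lintegral_mono_set fun x hx => ⟨hx.1, hx.2.trans_lt hX1⟩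
      _ = _ := lintegral_const_mul' _ _ (by norm_num)
  have hU : Set.Ioo (0 : ℝ) 1 = ⋃ n : ℕ, Set.Ioc 0 (1 - 1 / ((n : ℝ) + 1)) := by
    ext x
    simp only [Set.mem_Ioo, Set.mem_iUnion, Set.mem_Ioc]
    constructor
    · rintro ⟨hx0, hx1⟩
      obtain ⟨n, hn⟩ := exists_nat_one_div_lt (sub_pos.mpr hx1)
      exact ⟨n, hx0, by linarith⟩
    · rintro ⟨n, hx0, hx1⟩
      have : 0 < 1 / ((n : ℝ) + 1) := by positivity
      exact ⟨hx0, by linarith⟩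
  rw [hU, setLIntegral_iUnion_of_directed, ← hU]
  · refine iSup_le fun n => ?_
    have h1 : 0 < 1 / ((n : ℝ) + 1) := by positivity
    have h2 : 1 / ((n : ℝ) + 1) ≤ 1 := by
      rw [div_le_one (by positivity)]
      linarith [n.cast_nonneg (α := ℝ)]
    exact hbound _ (by linarith) (by linarith)
  · refine Monotone.directed_le fun m n hmn => Set.Ioc_subset_Ioc_right ?_
    have := Nat.one_div_le_one_div (α := ℝ) hmn
    linarith

open Real in
theorem lintegral_sub_center_le {g : ℂ → ℂ} (hg : DifferentiableOn ℂ g (Metric.ball 0 1)) :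
    ∫⁻ w in Metric.ball 0 1, ‖g w - g 0‖ₑ ^ 2
      ≤ 4 * ∫⁻ w in Metric.ball (0 : ℂ) 1,
          ‖deriv g w‖ₑ ^ 2 * ENNReal.ofReal ((1 - ‖w‖) ^ 2 / ‖w‖) := by
  have hm : AEMeasurable (fun p : ℝ × ℝ => ENNReal.ofReal p.1 *
      ‖g (circleMap 0 p.1 p.2) - g 0‖ₑ ^ 2)
      (volume.restrict (Set.Ioo 0 1 ×ˢ Set.Ioo (-π) π)) := by
    have := aemeasurable_comp_circleMap hg.continuousOn
    exact (by fun_prop : Measurable fun p : ℝ × ℝ => ENNReal.ofReal p.1).aemeasurable.mul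
      ((this.sub_const _).enorm.pow_const 2)
  have hm' : Measurable (fun p : ℝ × ℝ => ENNReal.ofReal p.1 *
      (‖deriv g (circleMap 0 p.1 p.2)‖ₑ ^ 2 *
        ENNReal.ofReal ((1 - ‖circleMap 0 p.1 p.2‖) ^ 2 / ‖circleMap 0 p.1 p.2‖))) := by
    have := measurable_deriv g
    simp only [circleMap]
    fun_prop
  rw [lintegral_ball_eq_polar, lintegral_ball_eq_polar]
  rw [Measure.volume_eq_prod, ← Measure.prod_restrict] at hm ⊢
  rw [lintegral_prod_symm _ hm, lintegral_prod_symm _ hm'.aemeasurable,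
    ← lintegral_const_mul' _ _ (by norm_num)]
  refine lintegral_mono fun θ => ?_
  have hball : ∀ ρ ∈ Set.Ico (0 : ℝ) 1, circleMap 0 ρ θ ∈ Metric.ball (0 : ℂ) 1 := by
    intro ρ hρ
    simpa [abs_of_nonneg hρ.1] using hρ.2
  have hray : ∀ ρ : ℝ, HasDerivAt (fun ρ : ℝ => circleMap 0 ρ θ) (Complex.exp (θ * Complex.I)) ρ := by
    intro ρ
    have := (Complex.ofRealCLM.hasDerivAt (x := ρ)).mul_const (Complex.exp (θ * Complex.I))
    simpa [circleMap] using this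
  have hd : ∀ ρ ∈ Set.Ico (0 : ℝ) 1, HasDerivAt (fun ρ => g (circleMap 0 ρ θ) - g 0)
      (deriv g (circleMap 0 ρ θ) * Complex.exp (θ * Complex.I)) ρ := by
    intro ρ hρ
    have h1 := (hg.differentiableAt (Metric.isOpen_ball.mem_nhds (hball ρ hρ))).hasDerivAt
    exact (h1.comp_of_eq ρ (hray ρ) rfl).sub_const _
  have hc : ContinuousOn (fun ρ : ℝ => deriv g (circleMap 0 ρ θ) * Complex.exp (θ * Complex.I))
      (Set.Ico 0 1) := by
    refine ContinuousOn.mul ?_ continuousOn_const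
    refine (hg.deriv Metric.isOpen_ball).continuousOn.comp (f := fun ρ : ℝ => circleMap 0 ρ θ) ?_
      hball
    exact fun ρ _ => (hray ρ).continuousAt.continuousWithinAt
  calc ∫⁻ ρ in Set.Ioo 0 1, ENNReal.ofReal ρ * ‖g (circleMap 0 ρ θ) - g 0‖ₑ ^ 2
      ≤ ∫⁻ ρ in Set.Ioo 0 1, ‖g (circleMap 0 ρ θ) - g 0‖ₑ ^ 2 := by
        refine setLIntegral_mono' measurableSet_Ioo fun ρ hρ => ?_
        exact mul_le_of_le_one_left' (ENNReal.ofReal_le_one.mpr hρ.2.le)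
    _ ≤ _ := lintegral_hardy hd hc (by simp [circleMap])
    _ = _ := by
        congr 1
        refine setLIntegral_congr_fun measurableSet_Ioo fun ρ hρ => ?_
        have he : ‖Complex.exp (θ * Complex.I)‖ₑ = 1 := by
          rw [← ofReal_norm, Complex.norm_exp_ofReal_mul_I, ENNReal.ofReal_one]
        simp only [enorm_mul, he, mul_one, norm_circleMap_zero, abs_of_pos hρ.1]
        rw [mul_left_comm, ← ENNReal.ofReal_mul hρ.1.le, mul_div_cancel₀ _ hρ.1.ne']

/-- The Poisson integral of `μ` as an extended nonnegative number. -/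
def ePoissonInt (μ : Measure ℂ) (z : ℂ) : ENNReal :=
  ENNReal.ofReal (2 * Real.pi)⁻¹ * ∫⁻ ζ, ENNReal.ofReal ((1 - ‖z‖ ^ 2) / ‖ζ - z‖ ^ 2) ∂μ

theorem ofReal_poissonInt {μ : Measure ℂ} [IsFiniteMeasure μ] (hμ : ∀ᵐ ζ ∂μ, ‖ζ‖ = 1) {z : ℂ}
    (hz : ‖z‖ < 1) : ENNReal.ofReal (poissonInt μ z) = ePoissonInt μ z := by
  have hpi := Real.pi_pos
  have h1 : 0 < 1 - ‖z‖ ^ 2 := by nlinarith [norm_nonneg z]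
  have hint : Integrable (fun ζ => (1 - ‖z‖ ^ 2) / ‖ζ - z‖ ^ 2) μ := by
    refine Integrable.of_bound (C := (1 - ‖z‖ ^ 2) / (1 - ‖z‖) ^ 2) ?_ ?_
    · exact Measurable.aestronglyMeasurable (by fun_prop)
    · filter_upwards [hμ] with ζ hζ
      have h2 : 1 - ‖z‖ ≤ ‖ζ - z‖ := hζ ▸ norm_sub_norm_le ζ z
      have h3 : 0 < 1 - ‖z‖ := by linarith
      rw [Real.norm_of_nonneg (by positivity)]
      gcongr
  rw [poissonInt, ENNReal.ofReal_mul (by positivity), ofReal_integral_eq_lintegral_ofReal hint,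
    ePoissonInt]
  exact Filter.Eventually.of_forall fun ζ => by simp only [Pi.zero_apply]; positivity

theorem poissonInt_nonneg (μ : Measure ℂ) {z : ℂ} (hz : ‖z‖ < 1) : 0 ≤ poissonInt μ z := by
  have hpi := Real.pi_pos
  have h1 : 0 < 1 - ‖z‖ ^ 2 := by nlinarith [norm_nonneg z]
  exact mul_nonneg (by positivity) (integral_nonneg fun ζ => by positivity)

theorem measurable_ePoissonInt (μ : Measure ℂ) [IsFiniteMeasure μ] :
    Measurable (ePoissonInt μ) := by
  refine Measurable.const_mul ?_ _
  exact Measurable.lintegral_prod_right' (ν := μ)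
    (f := fun p : ℂ × ℂ => ENNReal.ofReal ((1 - ‖p.1‖ ^ 2) / ‖p.2 - p.1‖ ^ 2)) (by fun_prop)

theorem measurable_moebius_prod : Measurable fun p : ℂ × ℂ => moebius p.1 p.2 := by
  have h : Measurable fun z : ℂ => (starRingEnd ℂ) z := Complex.continuous_conj.measurable
  unfold moebius
  fun_prop

theorem measurable_moebiusJac_prod : Measurable fun p : ℂ × ℂ => moebiusJac p.1 p.2 := by
  have h : Measurable fun z : ℂ => (starRingEnd ℂ) z := Complex.continuous_conj.measurable
  unfold moebiusJac
  fun_prop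

theorem poisson_moebius {u w ζ : ℂ} (hu : ‖u‖ < 1) (hw : ‖w‖ < 1) (hζ : ‖ζ‖ = 1) :
    (1 - ‖moebius u w‖ ^ 2) / ‖ζ - moebius u w‖ ^ 2
      = (1 - ‖u‖ ^ 2) / ‖ζ - u‖ ^ 2 * ((1 - ‖w‖ ^ 2) / ‖moebius u ζ - w‖ ^ 2) := by
  have hd := one_sub_conj_mul_ne_zero hu hw.le
  have hd' := one_sub_conj_mul_ne_zero hu hζ.le
  have h1 : ‖1 - (starRingEnd ℂ) u * ζ‖ = ‖ζ - u‖ := by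
    have h := norm_sq_one_sub_conj_mul_sub u ζ
    rw [hζ, norm_sub_rev u ζ] at h
    have h' : ‖1 - (starRingEnd ℂ) u * ζ‖ ^ 2 = ‖ζ - u‖ ^ 2 := by linarith
    exact (sq_eq_sq₀ (norm_nonneg _) (norm_nonneg _)).mp h'
  have h2 : (ζ - moebius u w) * (1 - (starRingEnd ℂ) u * w)
      = -((moebius u ζ - w) * (1 - (starRingEnd ℂ) u * ζ)) := by
    rw [moebius, moebius, sub_mul, sub_mul, div_mul_cancel₀ _ hd, div_mul_cancel₀ _ hd']
    ring
  have h3 := congrArg norm h2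
  rw [norm_neg, norm_mul, norm_mul, h1] at h3
  have hn : ‖1 - (starRingEnd ℂ) u * w‖ ≠ 0 := norm_ne_zero_iff.mpr hd
  rw [one_sub_norm_moebius_sq hu hw.le, div_div, ← mul_pow, mul_comm ‖1 - _ * w‖, h3, mul_pow,
    div_mul_div_comm, mul_comm (‖moebius u ζ - w‖ ^ 2)]

theorem lintegral_ePoissonInt_moebius_le {μ : Measure ℂ} [IsFiniteMeasure μ]
    (hμ : ∀ᵐ ζ ∂μ, ‖ζ‖ = 1) {u : ℂ} (hu : ‖u‖ < 1) :
    ∫⁻ w in Metric.ball 0 1, ENNReal.ofReal ‖w‖⁻¹ * ePoissonInt μ (moebius u w)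
      ≤ ENNReal.ofReal (2 * Real.pi) * ePoissonInt μ u := by
  have hmu : Measurable fun w : ℂ => moebius u w :=
    measurable_moebius_prod.comp (measurable_const.prodMk measurable_id)
  have hm : Measurable fun p : ℂ × ℂ => ENNReal.ofReal ‖p.1‖⁻¹ *
      ENNReal.ofReal ((1 - ‖moebius u p.1‖ ^ 2) / ‖p.2 - moebius u p.1‖ ^ 2) := by
    have : Measurable fun p : ℂ × ℂ => moebius u p.1 := hmu.comp measurable_fst
    fun_prop
  calc ∫⁻ w in Metric.ball 0 1, ENNReal.ofReal ‖w‖⁻¹ * ePoissonInt μ (moebius u w)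
      = ENNReal.ofReal (2 * Real.pi)⁻¹ * ∫⁻ w in Metric.ball (0 : ℂ) 1, ∫⁻ ζ,
          ENNReal.ofReal ‖w‖⁻¹ *
            ENNReal.ofReal ((1 - ‖moebius u w‖ ^ 2) / ‖ζ - moebius u w‖ ^ 2) ∂μ := by
        rw [← lintegral_const_mul' _ _ ENNReal.ofReal_ne_top]
        refine lintegral_congr fun w => ?_
        rw [lintegral_const_mul' _ _ ENNReal.ofReal_ne_top, ePoissonInt, mul_left_comm]
    _ = ENNReal.ofReal (2 * Real.pi)⁻¹ * ∫⁻ ζ, (∫⁻ w in Metric.ball (0 : ℂ) 1,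
          ENNReal.ofReal ‖w‖⁻¹ *
            ENNReal.ofReal ((1 - ‖moebius u w‖ ^ 2) / ‖ζ - moebius u w‖ ^ 2)) ∂μ := by
        rw [lintegral_lintegral_swap hm.aemeasurable]
    _ ≤ ENNReal.ofReal (2 * Real.pi)⁻¹ * ∫⁻ ζ, ENNReal.ofReal (2 * Real.pi) *
          ENNReal.ofReal ((1 - ‖u‖ ^ 2) / ‖ζ - u‖ ^ 2) ∂μ := by
        gcongr 1
        refine lintegral_mono_ae ?_
        filter_upwards [hμ] with ζ hζ
        have hp : 0 ≤ (1 - ‖u‖ ^ 2) / ‖ζ - u‖ ^ 2 :=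
          div_nonneg (by nlinarith [norm_nonneg u]) (by positivity)
        calc _ = ∫⁻ w in Metric.ball (0 : ℂ) 1, ENNReal.ofReal ((1 - ‖u‖ ^ 2) / ‖ζ - u‖ ^ 2) *
              (ENNReal.ofReal ((1 - ‖w‖ ^ 2) / ‖moebius u ζ - w‖ ^ 2) *
                ENNReal.ofReal ‖w‖⁻¹) := by
              refine setLIntegral_congr_fun Metric.isOpen_ball.measurableSet fun w hw => ?_
              rw [Metric.mem_ball, dist_zero_right] at hw
              simp only [poisson_moebius hu hw hζ, ENNReal.ofReal_mul hp]
              ring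
          _ ≤ _ := by
              rw [lintegral_const_mul' _ _ ENNReal.ofReal_ne_top, mul_comm]
              gcongr
              exact lintegral_poisson_div_norm_le (norm_moebius_eq_one hu hζ)
    _ = _ := by
        rw [lintegral_const_mul' _ _ ENNReal.ofReal_ne_top, ePoissonInt, mul_left_comm]

theorem differentiableOn_comp_moebius {f : ℂ → ℂ} (hf : DifferentiableOn ℂ f (Metric.ball 0 1))
    {z : ℂ} (hz : ‖z‖ < 1) :
    DifferentiableOn ℂ (fun w => f (moebius z w)) (Metric.ball 0 1) := by
  refine hf.comp (fun w hw => ?_) (fun w hw => ?_)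
  · exact (hasDerivAt_moebius hz (by simpa using hw)).differentiableAt.differentiableWithinAt
  · simpa using norm_moebius_lt_one hz (by simpa using hw)

theorem norm_deriv_comp_moebius_sq {f : ℂ → ℂ} (hf : DifferentiableOn ℂ f (Metric.ball 0 1))
    {z w : ℂ} (hz : ‖z‖ < 1) (hw : ‖w‖ < 1) :
    ‖deriv (fun w => f (moebius z w)) w‖ ^ 2
      = moebiusJac z w * ‖deriv f (moebius z w)‖ ^ 2 := by
  have h1 := (hf.differentiableAt (x := moebius z w) (Metric.isOpen_ball.mem_nhds
    (by simpa using norm_moebius_lt_one hz hw))).hasDerivAt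
  have h2 : HasDerivAt (fun w => f (moebius z w)) _ w := h1.comp w (hasDerivAt_moebius hz hw)
  rw [h2.deriv, norm_mul, mul_pow, norm_deriv_moebius_sq hz, mul_comm]

theorem enorm_sq_eq_ofReal (x : ℂ) : ‖x‖ₑ ^ 2 = ENNReal.ofReal (‖x‖ ^ 2) := by
  rw [ENNReal.ofReal_pow (norm_nonneg _), ofReal_norm]

theorem moebiusJac_nonneg (z w : ℂ) : 0 ≤ moebiusJac z w := sq_nonneg _

theorem lintegral_comp_moebius_sub_le {f : ℂ → ℂ}
    (hf : DifferentiableOn ℂ f (Metric.ball 0 1)) {z : ℂ} (hz : ‖z‖ < 1) :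
    ∫⁻ w in Metric.ball 0 1, ‖f (moebius z w) - f z‖ₑ ^ 2
      ≤ 4 * ∫⁻ u in Metric.ball 0 1, ‖deriv f u‖ₑ ^ 2 *
          ENNReal.ofReal ((1 - ‖moebius z u‖) ^ 2 / ‖moebius z u‖) := by
  have h := lintegral_sub_center_le (differentiableOn_comp_moebius hf hz)
  rw [moebius_zero_right] at h
  refine h.trans_eq ?_
  rw [← lintegral_ball_moebius hz (fun u => ‖deriv f u‖ₑ ^ 2 * _)]
  congr 1
  refine setLIntegral_congr_fun Metric.isOpen_ball.measurableSet fun w hw => ?_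
  rw [Metric.mem_ball, dist_zero_right] at hw
  simp only [enorm_sq_eq_ofReal]
  rw [norm_deriv_comp_moebius_sq hf hz hw, ENNReal.ofReal_mul (moebiusJac_nonneg z w),
    moebius_moebius hz hw, mul_assoc]

theorem radial_weight_moebius_le {z u : ℂ} (hz : ‖z‖ < 1) (hu : ‖u‖ < 1) :
    (1 - ‖moebius z u‖) ^ 2 / ‖moebius z u‖
      ≤ (1 - ‖z‖ ^ 2) ^ 2 * (moebiusJac u z * ‖moebius u z‖⁻¹) := by
  have h0 := norm_nonneg (moebius z u)
  have h1 := norm_moebius_lt_one hz hu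
  have h2 : (1 - ‖moebius z u‖) ^ 2 ≤ (1 - ‖moebius z u‖ ^ 2) ^ 2 := by
    refine pow_le_pow_left₀ (by linarith) ?_ 2
    nlinarith
  have h3 : (1 - ‖moebius z u‖ ^ 2) ^ 2 = (1 - ‖z‖ ^ 2) ^ 2 * moebiusJac u z := by
    rw [one_sub_norm_moebius_sq hz hu.le, moebiusJac, norm_one_sub_conj_mul_comm]
    ring
  rw [← mul_assoc, ← h3, norm_moebius_comm u z, ← div_eq_mul_inv]
  gcongr

theorem integrableOn_norm_sub_const_sq {f : ℂ → ℂ}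
    (hf : DifferentiableOn ℂ f (Metric.ball 0 1))
    (hfA2 : (∫⁻ z in Metric.ball (0 : ℂ) 1, ENNReal.ofReal (‖f z‖ ^ 2)) < ⊤) (c : ℂ) :
    IntegrableOn (fun w => ‖f w - c‖ ^ 2) (Metric.ball 0 1) := by
  have hm : AEStronglyMeasurable f (volume.restrict (Metric.ball 0 1)) :=
    hf.continuousOn.aestronglyMeasurable Metric.isOpen_ball.measurableSet
  have hfin : IsFiniteMeasure (volume.restrict (Metric.ball (0 : ℂ) 1)) :=
    ⟨by simp⟩
  have hL : MemLp f 2 (volume.restrict (Metric.ball 0 1)) := by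
    rw [memLp_two_iff_integrable_sq_norm hm]
    refine ⟨hm.norm.pow 2, ?_⟩
    rwa [hasFiniteIntegral_iff_ofReal (Filter.Eventually.of_forall fun x => by positivity)]
  have hL' := hL.sub (memLp_const c)
  exact (memLp_two_iff_integrable_sq_norm hL'.1).mp hL'

theorem setLIntegral_enorm_sub_eq {f : ℂ → ℂ}
    (hf : DifferentiableOn ℂ f (Metric.ball 0 1))
    (hfA2 : (∫⁻ z in Metric.ball (0 : ℂ) 1, ENNReal.ofReal (‖f z‖ ^ 2)) < ⊤) (c : ℂ)
    {S : Set ℂ} (hS : S ⊆ Metric.ball 0 1) :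
    ENNReal.ofReal (∫ w in S, ‖f w - c‖ ^ 2) = ∫⁻ w in S, ‖f w - c‖ₑ ^ 2 := by
  rw [ofReal_integral_eq_lintegral_ofReal
    ((integrableOn_norm_sub_const_sq hf hfA2 c).mono_set hS)
    (Filter.Eventually.of_forall fun x => by positivity)]
  simp only [enorm_sq_eq_ofReal]

theorem le_moebiusJac {z w : ℂ} (hz : ‖z‖ < 1) (hw : ‖w‖ < 1) :
    (1 - ‖z‖ ^ 2) ^ 2 / 16 ≤ moebiusJac z w := by
  have h1 : ‖1 - (starRingEnd ℂ) z * w‖ ≤ 2 := by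
    refine (norm_sub_le _ _).trans ?_
    rw [norm_one, norm_mul, Complex.norm_conj]
    nlinarith [norm_nonneg z, norm_nonneg w]
  have h2 : 0 < ‖1 - (starRingEnd ℂ) z * w‖ :=
    norm_pos_iff.mpr (one_sub_conj_mul_ne_zero hz hw.le)
  rw [moebiusJac, div_pow, ← pow_mul]
  gcongr
  calc ‖1 - (starRingEnd ℂ) z * w‖ ^ (2 * 2) ≤ 2 ^ (2 * 2) := by gcongr
    _ = 16 := by norm_num

theorem moebiusJac_le {z w : ℂ} {s : ℝ} (hz : ‖z‖ < 1) (hs : s < 1) (hw : ‖w‖ ≤ s) :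
    moebiusJac z w ≤ (1 - ‖z‖ ^ 2) ^ 2 / (1 - s) ^ 4 := by
  have h1 : 1 - s ≤ ‖1 - (starRingEnd ℂ) z * w‖ := by
    have h := norm_sub_norm_le (1 : ℂ) ((starRingEnd ℂ) z * w)
    rw [norm_one, norm_mul, Complex.norm_conj] at h
    nlinarith [norm_nonneg z, norm_nonneg w]
  have h2 : 0 < 1 - s := by linarith
  rw [moebiusJac, div_pow, ← pow_mul]
  gcongr

theorem ofReal_MO_sq {f : ℂ → ℂ} (hf : DifferentiableOn ℂ f (Metric.ball 0 1))
    (hfA2 : (∫⁻ z in Metric.ball (0 : ℂ) 1, ENNReal.ofReal (‖f z‖ ^ 2)) < ⊤) {z : ℂ}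
    (hz : ‖z‖ < 1) :
    ENNReal.ofReal (MO f z ^ 2) = ∫⁻ w in Metric.ball 0 1, ‖f (moebius z w) - f z‖ₑ ^ 2 := by
  have hzp : 0 < 1 - ‖z‖ ^ 2 := by nlinarith [norm_nonneg z]
  have hlt : ∫⁻ w in Metric.ball 0 1, ‖f (moebius z w) - f z‖ₑ ^ 2 < ⊤ := by
    have h1 : ENNReal.ofReal ((1 - ‖z‖ ^ 2) ^ 2 / 16) *
        ∫⁻ w in Metric.ball 0 1, ‖f (moebius z w) - f z‖ₑ ^ 2
        ≤ ∫⁻ w in Metric.ball 0 1, ‖f w - f z‖ₑ ^ 2 := by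
      rw [← lintegral_ball_moebius hz (fun w => ‖f w - f z‖ₑ ^ 2),
        ← lintegral_const_mul' _ _ ENNReal.ofReal_ne_top]
      refine setLIntegral_mono' Metric.isOpen_ball.measurableSet fun w hw => ?_
      gcongr
      exact le_moebiusJac hz (by simpa using hw)
    have h2 : ∫⁻ w in Metric.ball 0 1, ‖f w - f z‖ₑ ^ 2 < ⊤ := by
      rw [← setLIntegral_enorm_sub_eq hf hfA2 (f z) subset_rfl]
      exact ENNReal.ofReal_lt_top
    have hc : ENNReal.ofReal ((1 - ‖z‖ ^ 2) ^ 2 / 16) ≠ 0 := by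
      rw [Ne, ENNReal.ofReal_eq_zero, not_le]
      positivity
    exact ENNReal.lt_top_of_mul_ne_top_right (h1.trans_lt h2).ne hc
  simp only [enorm_sq_eq_ofReal] at hlt ⊢
  rw [MO, Real.sq_sqrt (integral_nonneg fun w => by positivity),
    ofReal_integral_eq_lintegral_ofReal _ (Filter.Eventually.of_forall fun x => by positivity)]
  refine ⟨?_, ?_⟩
  · exact ((((differentiableOn_comp_moebius hf hz).continuousOn.aestronglyMeasurable
      Metric.isOpen_ball.measurableSet).sub aestronglyMeasurable_const).norm.pow 2)
  · rwa [hasFiniteIntegral_iff_ofReal (Filter.Eventually.of_forall fun x => by positivity)]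

theorem setLIntegral_enorm_sub_average_le {S : Set ℂ} {f : ℂ → ℂ} (hS : volume S ≠ 0)
    (hS' : volume S ≠ ⊤) (hf : IntegrableOn f S) (a : ℂ) :
    ∫⁻ w in S, ‖f w - (volume S).toReal⁻¹ • ∫ x in S, f x‖ₑ ^ 2
      ≤ 4 * ∫⁻ w in S, ‖f w - a‖ₑ ^ 2 := by
  set m := (volume S).toReal⁻¹ • ∫ x in S, f x with hm
  have hV : (volume S).toReal ≠ 0 := ENNReal.toReal_ne_zero.mpr ⟨hS, hS'⟩
  have hsub : m - a = (volume S).toReal⁻¹ • ∫ x in S, (f x - a) := by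
    rw [integral_sub hf (integrableOn_const hS'), setIntegral_const, smul_sub, hm, Measure.real,
      smul_smul, inv_mul_cancel₀ hV, one_smul]
  have hJ := enorm_integral_sq_le (hf.aestronglyMeasurable.sub
    (aestronglyMeasurable_const (b := a)))
  simp only [Pi.sub_apply, Measure.restrict_apply_univ] at hJ
  have hma : ‖m - a‖ₑ ^ 2 * volume S ≤ ∫⁻ w in S, ‖f w - a‖ₑ ^ 2 := by
    have hVe : ‖(volume S).toReal⁻¹‖ₑ = (volume S)⁻¹ := by
      rw [← ofReal_norm, Real.norm_of_nonneg (by positivity), ← ENNReal.toReal_inv,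
        ENNReal.ofReal_toReal (ENNReal.inv_ne_top.mpr hS)]
    calc ‖m - a‖ₑ ^ 2 * volume S
        = (volume S)⁻¹ * ((volume S)⁻¹ * volume S) * ‖∫ x in S, (f x - a)‖ₑ ^ 2 := by
          rw [hsub, enorm_smul, hVe]; ring
      _ ≤ (volume S)⁻¹ * (volume S * ∫⁻ w in S, ‖f w - a‖ₑ ^ 2) := by
          rw [ENNReal.inv_mul_cancel hS hS', mul_one]
          gcongr
      _ = _ := by rw [← mul_assoc, ENNReal.inv_mul_cancel hS hS', one_mul]
  calc ∫⁻ w in S, ‖f w - m‖ₑ ^ 2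
      ≤ ∫⁻ w in S, (2 * ‖f w - a‖ₑ ^ 2 + 2 * ‖m - a‖ₑ ^ 2) := by
        refine lintegral_mono fun w => ?_
        simp only [enorm_sq_eq_ofReal]
        rw [← ENNReal.ofReal_ofNat 2, ← ENNReal.ofReal_mul (by norm_num),
          ← ENNReal.ofReal_mul (by norm_num), ← ENNReal.ofReal_add (by positivity) (by positivity)]
        refine ENNReal.ofReal_le_ofReal ?_
        have h : ‖f w - m‖ ≤ ‖f w - a‖ + ‖m - a‖ := by
          simpa using norm_sub_le (f w - a) (m - a)
        nlinarith [norm_nonneg (f w - m), sq_nonneg (‖f w - a‖ - ‖m - a‖)]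
    _ = 2 * (∫⁻ w in S, ‖f w - a‖ₑ ^ 2) + 2 * (‖m - a‖ₑ ^ 2 * volume S) := by
        rw [lintegral_add_right _ measurable_const, lintegral_const_mul' _ _ (by norm_num),
          lintegral_const, Measure.restrict_apply_univ, mul_assoc]
    _ ≤ 2 * (∫⁻ w in S, ‖f w - a‖ₑ ^ 2) + 2 * ∫⁻ w in S, ‖f w - a‖ₑ ^ 2 := by gcongr
    _ = _ := by ring

section BergmanBall

variable {z : ℂ} {r : ℝ}

/-- The pseudo-hyperbolic radius of a Bergman ball of radius `r`. -/
def pseudoRadius (r : ℝ) : ℝ := (Real.exp r - 1) / (Real.exp r + 1)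

theorem pseudoRadius_lt_one (r : ℝ) : pseudoRadius r < 1 := by
  have he := Real.exp_pos r
  rw [pseudoRadius, div_lt_one (by linarith)]
  linarith

theorem pseudoRadius_pos (hr : 0 < r) : 0 < pseudoRadius r := by
  have he := Real.one_lt_exp_iff.mpr hr
  exact div_pos (by linarith) (by linarith)

theorem lintegral_bball (hz : ‖z‖ < 1) (F : ℂ → ENNReal) :
    ∫⁻ x in bball z r, F x = ∫⁻ w in Metric.ball 0 (pseudoRadius r),
      ENNReal.ofReal (moebiusJac z w) * F (moebius z w) := by
  rw [bball_eq_moebius_image hz, ← pseudoRadius, lintegral_moebius_image hz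
    (pseudoRadius_lt_one r).le]

theorem lintegral_bball_le (hz : ‖z‖ < 1) (F : ℂ → ENNReal) :
    ∫⁻ x in bball z r, F x ≤ ENNReal.ofReal ((1 - ‖z‖ ^ 2) ^ 2 / (1 - pseudoRadius r) ^ 4) *
      ∫⁻ w in Metric.ball 0 (pseudoRadius r), F (moebius z w) := by
  rw [lintegral_bball hz, ← lintegral_const_mul' _ _ ENNReal.ofReal_ne_top]
  refine setLIntegral_mono' Metric.isOpen_ball.measurableSet fun w hw => ?_
  gcongr
  exact moebiusJac_le hz (pseudoRadius_lt_one r) (by simpa using (Metric.mem_ball.mp hw).le)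

theorem le_lintegral_bball (hz : ‖z‖ < 1) (F : ℂ → ENNReal) :
    ENNReal.ofReal ((1 - ‖z‖ ^ 2) ^ 2 / 16) *
      ∫⁻ w in Metric.ball 0 (pseudoRadius r), F (moebius z w) ≤ ∫⁻ x in bball z r, F x := by
  rw [lintegral_bball hz, ← lintegral_const_mul' _ _ ENNReal.ofReal_ne_top]
  refine setLIntegral_mono' Metric.isOpen_ball.measurableSet fun w hw => ?_
  gcongr
  exact le_moebiusJac hz ((by simpa using hw : ‖w‖ < _).trans (pseudoRadius_lt_one r))

theorem volume_bball_le (hz : ‖z‖ < 1) :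
    volume (bball z r) ≤ ENNReal.ofReal ((1 - ‖z‖ ^ 2) ^ 2 / (1 - pseudoRadius r) ^ 4) *
      volume (Metric.ball (0 : ℂ) (pseudoRadius r)) := by
  simpa using lintegral_bball_le (r := r) hz fun _ => 1

theorem le_volume_bball (hz : ‖z‖ < 1) :
    ENNReal.ofReal ((1 - ‖z‖ ^ 2) ^ 2 / 16) * volume (Metric.ball (0 : ℂ) (pseudoRadius r))
      ≤ volume (bball z r) := by
  simpa using le_lintegral_bball (r := r) hz fun _ => 1

theorem volume_bball_ne_top (hz : ‖z‖ < 1) : volume (bball z r) ≠ ⊤ :=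
  ((volume_bball_le hz).trans_lt
    (ENNReal.mul_lt_top ENNReal.ofReal_lt_top measure_ball_lt_top)).ne

theorem volume_bball_ne_zero (hz : ‖z‖ < 1) (hr : 0 < r) : volume (bball z r) ≠ 0 := by
  have hzp : 0 < 1 - ‖z‖ ^ 2 := by nlinarith [norm_nonneg z]
  refine (lt_of_lt_of_le (ENNReal.mul_pos ?_ ?_) (le_volume_bball hz)).ne'
  · rw [Ne, ENNReal.ofReal_eq_zero, not_le]
    positivity
  · exact (Metric.measure_ball_pos volume 0 (pseudoRadius_pos hr)).ne'

theorem ofReal_MOr_sq {f : ℂ → ℂ} (hf : DifferentiableOn ℂ f (Metric.ball 0 1))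
    (hfA2 : (∫⁻ z in Metric.ball (0 : ℂ) 1, ENNReal.ofReal (‖f z‖ ^ 2)) < ⊤)
    (hz : ‖z‖ < 1) (hr : 0 < r) :
    ENNReal.ofReal (MOr f r z ^ 2)
      = (volume (bball z r))⁻¹ * ∫⁻ w in bball z r, ‖f w - bAvg f r z‖ₑ ^ 2 := by
  rw [MOr, Real.sq_sqrt (mul_nonneg (by positivity) (integral_nonneg fun w => by positivity)),
    ENNReal.ofReal_mul (by positivity), ← ENNReal.toReal_inv,
    ENNReal.ofReal_toReal (ENNReal.inv_ne_top.mpr (volume_bball_ne_zero hz hr)),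
    setLIntegral_enorm_sub_eq hf hfA2 _ fun w hw => hw.1]

end BergmanBall

theorem exists_MOr_sq_le {f : ℂ → ℂ} (hf : DifferentiableOn ℂ f (Metric.ball 0 1))
    (hfA2 : (∫⁻ z in Metric.ball (0 : ℂ) 1, ENNReal.ofReal (‖f z‖ ^ 2)) < ⊤)
    {r : ℝ} (hr : 0 < r) : ∃ C : ℝ, 0 ≤ C ∧ ∀ z : ℂ, ‖z‖ < 1 → MOr f r z ^ 2 ≤ C * MO f z ^ 2 := by
  set s := pseudoRadius r
  have hs1 : 0 < 1 - s := sub_pos.mpr (pseudoRadius_lt_one r)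
  set v := (volume (Metric.ball (0 : ℂ) s)).toReal with hv
  have hve : ENNReal.ofReal v = volume (Metric.ball (0 : ℂ) s) :=
    ENNReal.ofReal_toReal measure_ball_lt_top.ne
  have hvp : 0 < v := ENNReal.toReal_pos
    (Metric.measure_ball_pos volume 0 (pseudoRadius_pos hr)).ne' measure_ball_lt_top.ne
  refine ⟨64 / (v * (1 - s) ^ 4), by positivity, fun z hz => ?_⟩
  have hzp : 0 < 1 - ‖z‖ ^ 2 := by nlinarith [norm_nonneg z]
  rw [← ENNReal.ofReal_le_ofReal_iff (by positivity), ENNReal.ofReal_mul (by positivity),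
    ofReal_MOr_sq hf hfA2 hz hr, ofReal_MO_sq hf hfA2 hz]
  have hfi : IntegrableOn f (bball z r) := by
    have hsq := (integrableOn_norm_sub_const_sq hf hfA2 0).mono_set
      (fun w hw => hw.1 : bball z r ⊆ Metric.ball 0 1)
    have hm : AEStronglyMeasurable f (volume.restrict (bball z r)) :=
      (hf.continuousOn.aestronglyMeasurable Metric.isOpen_ball.measurableSet).mono_measure
        (Measure.restrict_mono_set volume fun w hw => hw.1)
    have hfin : IsFiniteMeasure (volume.restrict (bball z r)) :=
      ⟨by simpa using (volume_bball_ne_top hz).lt_top⟩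
    simp only [sub_zero] at hsq
    exact ((memLp_two_iff_integrable_sq_norm hm).mpr hsq).integrable one_le_two
  have h1 := setLIntegral_enorm_sub_average_le (volume_bball_ne_zero hz hr)
    (volume_bball_ne_top hz) hfi (f z)
  have h2 := lintegral_bball_le (r := r) hz fun w => ‖f w - f z‖ₑ ^ 2
  have h3 : ∫⁻ w in Metric.ball 0 s, ‖f (moebius z w) - f z‖ₑ ^ 2
      ≤ ∫⁻ w in Metric.ball 0 1, ‖f (moebius z w) - f z‖ₑ ^ 2 :=
    lintegral_mono_set (Metric.ball_subset_ball (pseudoRadius_lt_one r).le)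
  have h4 : (volume (bball z r))⁻¹ ≤ ENNReal.ofReal ((1 - ‖z‖ ^ 2) ^ 2 / 16 * v)⁻¹ := by
    rw [ENNReal.ofReal_inv_of_pos (by positivity), ENNReal.inv_le_inv,
      ENNReal.ofReal_mul (by positivity), hve]
    exact le_volume_bball hz
  calc (volume (bball z r))⁻¹ * ∫⁻ w in bball z r, ‖f w - bAvg f r z‖ₑ ^ 2
      ≤ ENNReal.ofReal ((1 - ‖z‖ ^ 2) ^ 2 / 16 * v)⁻¹ *
        (4 * (ENNReal.ofReal ((1 - ‖z‖ ^ 2) ^ 2 / (1 - s) ^ 4) *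
          ∫⁻ w in Metric.ball 0 1, ‖f (moebius z w) - f z‖ₑ ^ 2)) := by
        refine mul_le_mul' h4 (h1.trans ?_)
        gcongr
        exact h2.trans (by gcongr)
    _ = _ := by
        rw [← mul_assoc, ← mul_assoc, ← ENNReal.ofReal_ofNat 4,
          ← ENNReal.ofReal_mul (by positivity), ← ENNReal.ofReal_mul (by positivity)]
        congr 2
        field_simp
        norm_num

theorem exists_deriv_sq_le_MOr {f : ℂ → ℂ} (hf : DifferentiableOn ℂ f (Metric.ball 0 1))
    (hfA2 : (∫⁻ z in Metric.ball (0 : ℂ) 1, ENNReal.ofReal (‖f z‖ ^ 2)) < ⊤)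
    {r : ℝ} (hr : 0 < r) : ∃ C : ℝ, 0 ≤ C ∧ ∀ z : ℂ, ‖z‖ < 1 →
      ‖deriv f z‖ ^ 2 * (1 - ‖z‖ ^ 2) ^ 2 ≤ C * MOr f r z ^ 2 := by
  have hpi := Real.pi_pos
  set s := pseudoRadius r
  have hs0 : 0 < s := pseudoRadius_pos hr
  have hs1 : 0 < 1 - s := sub_pos.mpr (pseudoRadius_lt_one r)
  set v := (volume (Metric.ball (0 : ℂ) s)).toReal with hv
  have hve : ENNReal.ofReal v = volume (Metric.ball (0 : ℂ) s) :=
    ENNReal.ofReal_toReal measure_ball_lt_top.ne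
  have hvp : 0 < v := ENNReal.toReal_pos
    (Metric.measure_ball_pos volume 0 hs0).ne' measure_ball_lt_top.ne
  set κ := (1 - s) ^ 4 * Real.pi * s ^ 4 / (128 * v) with hκ
  have hκp : 0 < κ := by positivity
  refine ⟨κ⁻¹, by positivity, fun z hz => ?_⟩
  have hzp : 0 < 1 - ‖z‖ ^ 2 := by nlinarith [norm_nonneg z]
  rw [← div_eq_inv_mul, le_div_iff₀' hκp, ← ENNReal.ofReal_le_ofReal_iff (by positivity),
    ofReal_MOr_sq hf hfA2 hz hr]
  have h1 := enorm_deriv_sq_le_disc (differentiableOn_comp_moebius hf hz) (bAvg f r z) hs0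
    (pseudoRadius_lt_one r).le
  rw [enorm_sq_eq_ofReal, norm_deriv_comp_moebius_sq hf hz (by simp), moebius_zero_right] at h1
  have hJ : moebiusJac z 0 = (1 - ‖z‖ ^ 2) ^ 2 := by simp [moebiusJac]
  rw [hJ] at h1
  have h2 := le_lintegral_bball (r := r) hz fun w => ‖f w - bAvg f r z‖ₑ ^ 2
  have h4 : ENNReal.ofReal ((1 - ‖z‖ ^ 2) ^ 2 / (1 - s) ^ 4 * v)⁻¹ ≤ (volume (bball z r))⁻¹ := by
    rw [ENNReal.ofReal_inv_of_pos (by positivity), ENNReal.inv_le_inv,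
      ENNReal.ofReal_mul (by positivity), hve]
    exact volume_bball_le hz
  calc ENNReal.ofReal (κ * (‖deriv f z‖ ^ 2 * (1 - ‖z‖ ^ 2) ^ 2))
      = ENNReal.ofReal ((1 - ‖z‖ ^ 2) ^ 2 / (1 - s) ^ 4 * v)⁻¹ *
        (ENNReal.ofReal ((1 - ‖z‖ ^ 2) ^ 2 / 16) * (ENNReal.ofReal (Real.pi * s ^ 4 / 8) *
          ENNReal.ofReal ((1 - ‖z‖ ^ 2) ^ 2 * ‖deriv f z‖ ^ 2))) := by
        rw [← ENNReal.ofReal_mul (by positivity), ← ENNReal.ofReal_mul (by positivity),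
          ← ENNReal.ofReal_mul (by positivity)]
        congr 1
        rw [hκ]
        field_simp
        ring
    _ ≤ _ := mul_le_mul' h4 ((mul_le_mul_right h1 _).trans h2)

theorem setLIntegral_ofReal_lt_top_of_le {S : Set ℂ} (hS : MeasurableSet S) {X Y : ℂ → ℝ} {C : ℝ}
    (hC : 0 ≤ C) (h : ∀ z ∈ S, X z ≤ C * Y z)
    (hY : ∫⁻ z in S, ENNReal.ofReal (Y z) < ⊤) : ∫⁻ z in S, ENNReal.ofReal (X z) < ⊤ := by
  refine lt_of_le_of_lt ?_ (ENNReal.mul_lt_top (ENNReal.ofReal_lt_top (r := C)) hY)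
  rw [← lintegral_const_mul' _ _ ENNReal.ofReal_ne_top]
  refine setLIntegral_mono' hS fun z hz => ?_
  rw [← ENNReal.ofReal_mul hC]
  exact ENNReal.ofReal_le_ofReal (h z hz)

theorem lintegral_MO_lt_top_of_deriv {μ : Measure ℂ} [IsFiniteMeasure μ]
    (hμ : ∀ᵐ ζ ∂μ, ‖ζ‖ = 1) {f : ℂ → ℂ} (hf : DifferentiableOn ℂ f (Metric.ball 0 1))
    (hfA2 : (∫⁻ z in Metric.ball (0 : ℂ) 1, ENNReal.ofReal (‖f z‖ ^ 2)) < ⊤)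
    (h : (∫⁻ z in Metric.ball (0 : ℂ) 1,
      ENNReal.ofReal (‖deriv f z‖ ^ 2 * poissonInt μ z)) < ⊤) :
    (∫⁻ z in Metric.ball (0 : ℂ) 1,
      ENNReal.ofReal ((MO f z) ^ 2 * poissonInt μ z / (1 - ‖z‖ ^ 2) ^ 2)) < ⊤ := by
  have hB : MeasurableSet (Metric.ball (0 : ℂ) 1) := Metric.isOpen_ball.measurableSet
  have hm : Measurable fun p : ℂ × ℂ => ‖deriv f p.2‖ₑ ^ 2 *
      (ENNReal.ofReal (moebiusJac p.2 p.1) *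
        (ENNReal.ofReal ‖moebius p.2 p.1‖⁻¹ * ePoissonInt μ p.1)) := by
    have h1 := measurable_deriv f
    have h2 := measurable_moebiusJac_prod.comp measurable_swap
    have h3 := measurable_moebius_prod.comp measurable_swap
    have h4 := measurable_ePoissonInt μ
    simp only [Function.comp_def, Prod.fst_swap, Prod.snd_swap] at h2 h3
    fun_prop
  calc ∫⁻ z in Metric.ball (0 : ℂ) 1,
        ENNReal.ofReal ((MO f z) ^ 2 * poissonInt μ z / (1 - ‖z‖ ^ 2) ^ 2)
      ≤ ∫⁻ z in Metric.ball (0 : ℂ) 1, 4 * ∫⁻ u in Metric.ball (0 : ℂ) 1, ‖deriv f u‖ₑ ^ 2 *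
          (ENNReal.ofReal (moebiusJac u z) *
            (ENNReal.ofReal ‖moebius u z‖⁻¹ * ePoissonInt μ z)) := by
        refine setLIntegral_mono' hB fun z hz => ?_
        rw [Metric.mem_ball, dist_zero_right] at hz
        have hzp : 0 < 1 - ‖z‖ ^ 2 := by nlinarith [norm_nonneg z]
        have hP : ePoissonInt μ z * ENNReal.ofReal ((1 - ‖z‖ ^ 2) ^ 2)⁻¹ ≠ ⊤ := by
          rw [← ofReal_poissonInt hμ hz]
          exact ENNReal.mul_ne_top ENNReal.ofReal_ne_top ENNReal.ofReal_ne_top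
        rw [mul_div_assoc, ENNReal.ofReal_mul (by positivity), div_eq_mul_inv,
          ENNReal.ofReal_mul (poissonInt_nonneg μ hz), ofReal_poissonInt hμ hz,
          ofReal_MO_sq hf hfA2 hz]
        refine (mul_le_mul_left (lintegral_comp_moebius_sub_le hf hz) _).trans ?_
        rw [mul_assoc, ← lintegral_mul_const' _ _ hP]
        gcongr 1
        refine setLIntegral_mono' hB fun u hu => ?_
        rw [Metric.mem_ball, dist_zero_right] at hu
        rw [mul_assoc]
        gcongr 1
        calc _ ≤ ENNReal.ofReal ((1 - ‖z‖ ^ 2) ^ 2 * (moebiusJac u z * ‖moebius u z‖⁻¹)) *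
              (ePoissonInt μ z * ENNReal.ofReal ((1 - ‖z‖ ^ 2) ^ 2)⁻¹) := by
              gcongr
              exact radial_weight_moebius_le hz hu
          _ = (ENNReal.ofReal ((1 - ‖z‖ ^ 2) ^ 2) * ENNReal.ofReal ((1 - ‖z‖ ^ 2) ^ 2)⁻¹) *
              (ENNReal.ofReal (moebiusJac u z) *
                (ENNReal.ofReal ‖moebius u z‖⁻¹ * ePoissonInt μ z)) := by
              rw [ENNReal.ofReal_mul (by positivity), ENNReal.ofReal_mul (moebiusJac_nonneg u z)]
              ring
          _ = _ := by
              rw [← ENNReal.ofReal_mul (by positivity), mul_inv_cancel₀ (by positivity),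
                ENNReal.ofReal_one, one_mul]
    _ = 4 * ∫⁻ u in Metric.ball (0 : ℂ) 1, ∫⁻ z in Metric.ball (0 : ℂ) 1, ‖deriv f u‖ₑ ^ 2 *
          (ENNReal.ofReal (moebiusJac u z) *
            (ENNReal.ofReal ‖moebius u z‖⁻¹ * ePoissonInt μ z)) := by
        rw [lintegral_const_mul' _ _ (by norm_num), lintegral_lintegral_swap hm.aemeasurable]
    _ ≤ 4 * ∫⁻ u in Metric.ball (0 : ℂ) 1, ENNReal.ofReal (2 * Real.pi) *
          ENNReal.ofReal (‖deriv f u‖ ^ 2 * poissonInt μ u) := by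
        gcongr 1
        refine setLIntegral_mono' hB fun u hu => ?_
        rw [Metric.mem_ball, dist_zero_right] at hu
        rw [lintegral_const_mul' _ _ (ENNReal.pow_ne_top enorm_ne_top),
          ENNReal.ofReal_mul (sq_nonneg ‖deriv f u‖), ofReal_poissonInt hμ hu, ← enorm_sq_eq_ofReal,
          mul_left_comm]
        gcongr 1
        refine le_trans (le_of_eq ?_) (lintegral_ePoissonInt_moebius_le hμ hu)
        refine Eq.trans ?_ (lintegral_ball_moebius hu fun w =>
          ENNReal.ofReal ‖w‖⁻¹ * ePoissonInt μ (moebius u w))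
        refine setLIntegral_congr_fun hB fun z hz => ?_
        rw [Metric.mem_ball, dist_zero_right] at hz
        simp only [moebius_moebius hu hz]
    _ < ⊤ := by
        rw [lintegral_const_mul' _ _ ENNReal.ofReal_ne_top]
        exact ENNReal.mul_lt_top (by norm_num) (ENNReal.mul_lt_top ENNReal.ofReal_lt_top h)

theorem stmt6 (μ : Measure ℂ) [IsFiniteMeasure μ] (hμ : μ ((Metric.sphere (0:ℂ) 1)ᶜ) = 0)
    (f : ℂ → ℂ) (hf : DifferentiableOn ℂ f (Metric.ball (0:ℂ) 1))
    (hfA2 : (∫⁻ z in Metric.ball (0:ℂ) 1, ENNReal.ofReal (‖f z‖ ^ 2)) < ⊤)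
    (r : ℝ) (hr : 0 < r) :
    ((∫⁻ z in Metric.ball (0:ℂ) 1,
        ENNReal.ofReal (‖deriv f z‖ ^ 2 * poissonInt μ z)) < ⊤ ↔
      (∫⁻ z in Metric.ball (0:ℂ) 1,
        ENNReal.ofReal ((MO f z) ^ 2 * poissonInt μ z / (1 - ‖z‖ ^ 2) ^ 2)) < ⊤)
    ∧
    ((∫⁻ z in Metric.ball (0:ℂ) 1,
        ENNReal.ofReal ((MO f z) ^ 2 * poissonInt μ z / (1 - ‖z‖ ^ 2) ^ 2)) < ⊤ ↔
      (∫⁻ z in Metric.ball (0:ℂ) 1,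
        ENNReal.ofReal ((MOr f r z) ^ 2 * poissonInt μ z / (1 - ‖z‖ ^ 2) ^ 2)) < ⊤) := by
  have hμ' : ∀ᵐ ζ ∂μ, ‖ζ‖ = 1 := by
    rw [ae_iff]
    convert hμ using 2
    ext ζ
    simp
  have hB : MeasurableSet (Metric.ball (0 : ℂ) 1) := Metric.isOpen_ball.measurableSet
  obtain ⟨C₁, hC₁, h₁⟩ := exists_MOr_sq_le hf hfA2 hr
  obtain ⟨C₂, hC₂, h₂⟩ := exists_deriv_sq_le_MOr hf hfA2 hr
  have deriv_MO := lintegral_MO_lt_top_of_deriv hμ' hf hfA2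
  have MO_MOr := setLIntegral_ofReal_lt_top_of_le hB hC₁
    (X := fun z => (MOr f r z) ^ 2 * poissonInt μ z / (1 - ‖z‖ ^ 2) ^ 2)
    (Y := fun z => (MO f z) ^ 2 * poissonInt μ z / (1 - ‖z‖ ^ 2) ^ 2) (fun z hz => by
      rw [Metric.mem_ball, dist_zero_right] at hz
      have hP := poissonInt_nonneg μ hz
      rw [mul_div_assoc', ← mul_assoc]
      gcongr
      exact h₁ z hz)
  have MOr_deriv := setLIntegral_ofReal_lt_top_of_le hB hC₂
    (X := fun z => ‖deriv f z‖ ^ 2 * poissonInt μ z)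
    (Y := fun z => (MOr f r z) ^ 2 * poissonInt μ z / (1 - ‖z‖ ^ 2) ^ 2) (fun z hz => by
      rw [Metric.mem_ball, dist_zero_right] at hz
      have hP := poissonInt_nonneg μ hz
      have hzp : 0 < 1 - ‖z‖ ^ 2 := by nlinarith [norm_nonneg z]
      rw [mul_div_assoc', ← mul_assoc, le_div_iff₀ (by positivity), mul_right_comm]
      exact mul_le_mul_of_nonneg_right (h₂ z hz) hP)
  exact ⟨⟨deriv_MO, MOr_deriv ∘ MO_MOr⟩, ⟨MO_MOr, deriv_MO ∘ MOr_deriv⟩⟩
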